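/- Let a ∈ ℂ and N ∈ ℕ, and define (Zf)(x) = −f(x−1) for functions f : ℂ → ℂ. For 0 ≤ n ≤ N define aₙ(x) = (x+a)ₙ·(x+1−a−N)_{N−n}, where (z)ₘ denotes the Pochhammer symbol. Assume k+a ≠ 0, k+a−1 ≠ 0 and 2a+2k−1 ≠ 0. Then for every 1 ≤ k ≤ N−1 and all x ∈ ℂ, Z acts tridiagonally: (Zaₖ)(x) = [ (N−k)(2a+k−1) / ( 2(k+a)(2a+2k−1) ) ] · (a_{k+1}(x) − aₖ(x)) − aₖ(x) − [ k(2a+N+k−1) / ( 2(k+a−1)(2a+2k−1) ) ] · (a_{k−1}(x) − aₖ(x)); moreover for k = 0 the last bracketed term is absent (its coefficient carries the factor k = 0), and for k = N the first bracketed term is absent (its coefficient carries the factor N−k = 0). -/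

import Mathlib

/-- The Pochhammer symbol `(z)ₘ = z (z+1) ⋯ (z+m-1)`. -/
noncomputable def poch (z : ℂ) (m : ℕ) : ℂ := ∏ i ∈ Finset.range m, (z + i)

/-- The basis `aₙ(x) = (x+a)ₙ (x+1-a-N)_{N-n}` (the `V`-eigenbasis). -/
noncomputable def aFun (a : ℂ) (N n : ℕ) (x : ℂ) : ℂ :=
  poch (x + a) n * poch (x + 1 - a - N) (N - n)

/-- The difference operator `Z`, acting by `(Z f)(x) = -f(x-1)`. -/
noncomputable def Zop (f : ℂ → ℂ) : ℂ → ℂ :=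
  fun x => -f (x - 1)

theorem poch_succ (z : ℂ) (m : ℕ) : poch z (m + 1) = poch z m * (z + m) :=
  Finset.prod_range_succ _ _

theorem poch_succ' (z : ℂ) (m : ℕ) : poch z (m + 1) = z * poch (z + 1) m := by
  simp only [poch, Finset.prod_range_succ', Nat.cast_zero, add_zero, Nat.cast_add, Nat.cast_one]
  rw [mul_comm]
  congr 1
  exact Finset.prod_congr rfl fun i _ => by ring

theorem poch_zero (z : ℂ) : poch z 0 = 1 := Finset.prod_range_zero _

theorem poch_sub_one_succ (z : ℂ) (m : ℕ) : poch (z - 1) (m + 1) = (z - 1) * poch z m := by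
  rw [poch_succ', sub_add_cancel]

/-- `Z` acts tridiagonally on the eigenbasis `aₖ` of `V`:
for `1 ≤ k ≤ N-1`,
`Z aₖ = ((N-k)(2a+k-1) / (2(k+a)(2a+2k-1))) (a_{k+1} - aₖ) - aₖ
        - (k(2a+N+k-1) / (2(k+a-1)(2a+2k-1))) (a_{k-1} - aₖ)`,
and for `k = 0` (resp. `k = N`) the last (resp. first) term, whose coefficient carries the
factor `k = 0` (resp. `N - k = 0`), is absent. -/
theorem Z_tridiagonal (a : ℂ) (N : ℕ)
    (h1 : ∀ k ≤ N, (k : ℂ) + a ≠ 0)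
    (h2 : ∀ k ≤ N, (k : ℂ) + a - 1 ≠ 0)
    (h3 : ∀ k ≤ N, 2 * a + 2 * (k : ℂ) - 1 ≠ 0) :
    (∀ k : ℕ, 1 ≤ k → k ≤ N - 1 → ∀ x : ℂ,
      Zop (aFun a N k) x =
        (((N : ℂ) - k) * (2 * a + k - 1) / (2 * ((k : ℂ) + a) * (2 * a + 2 * k - 1)))
            * (aFun a N (k + 1) x - aFun a N k x)
          - aFun a N k x
          - ((k : ℂ) * (2 * a + (N : ℂ) + k - 1) /
                (2 * ((k : ℂ) + a - 1) * (2 * a + 2 * k - 1)))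
            * (aFun a N (k - 1) x - aFun a N k x)) ∧
    (∀ x : ℂ,
      Zop (aFun a N 0) x =
        ((N : ℂ) * (2 * a - 1) / (2 * a * (2 * a - 1)))
            * (aFun a N 1 x - aFun a N 0 x)
          - aFun a N 0 x) ∧
    (∀ x : ℂ,
      Zop (aFun a N N) x =
        - aFun a N N x
          - ((N : ℂ) * (2 * a + (N : ℂ) + N - 1) /
                (2 * ((N : ℂ) + a - 1) * (2 * a + 2 * N - 1)))
            * (aFun a N (N - 1) x - aFun a N N x)) := by
  refine ⟨fun k hk hkN x => ?_, fun x => ?_, fun x => ?_⟩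
  · obtain ⟨j, rfl⟩ : ∃ j, k = j + 1 := ⟨k - 1, by omega⟩
    obtain ⟨m, rfl⟩ : ∃ m, N = j + 1 + (m + 1) := ⟨N - (j + 2), by omega⟩
    have e1 := h1 (j + 1) (by omega)
    have e2 := h2 (j + 1) (by omega)
    have e3 := h3 (j + 1) (by omega)
    have s1 : j + 1 + (m + 1) - (j + 1) = m + 1 := by omega
    have s2 : j + 1 + (m + 1) - (j + 1 + 1) = m := by omega
    have s3 : j + 1 + (m + 1) - j = m + 1 + 1 := by omega
    simp only [Zop, aFun, Nat.add_sub_cancel, s1, s2, s3]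
    rw [show x - 1 + a = x + a - 1 by ring,
      show ∀ c : ℂ, x - 1 + 1 - a - c = x + 1 - a - c - 1 by intro c; ring]
    rw [poch_sub_one_succ, poch_sub_one_succ]
    simp only [poch_succ]
    generalize poch (x + a) j = Q
    generalize poch (x + 1 - a - ((j + 1 + (m + 1) : ℕ) : ℂ)) m = R
    push_cast at e1 e2 e3 ⊢
    have d2 : (j : ℂ) + 1 + a - 1 = j + a := by ring
    have d3 : 2 * a + 2 * ((j : ℂ) + 1) - 1 = 2 * a + 2 * j + 1 := by ring
    rw [d2] at e2 ⊢
    rw [d3] at e3 ⊢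
    replace e3 : 2 * (a + j) + 1 ≠ 0 := by rwa [mul_add]
    field_simp
    ring
  · rcases N with _ | m
    · simp [Zop, aFun, poch_zero]
    have e1 : a ≠ 0 := by simpa using h1 0 (by omega)
    have e3 : 2 * a - 1 ≠ 0 := by simpa using h3 0 (by omega)
    simp only [Zop, aFun, Nat.sub_zero, Nat.add_sub_cancel]
    rw [show ∀ c : ℂ, x - 1 + 1 - a - c = x + 1 - a - c - 1 by intro c; ring]
    rw [poch_sub_one_succ]
    simp only [poch_succ, poch_zero]
    rw [mul_div_mul_right _ _ e3]
    push_cast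
    field_simp
    ring
  · rcases N with _ | j
    · simp [Zop, aFun, poch_zero]
    have e2 := h2 (j + 1) le_rfl
    have e3 := h3 (j + 1) le_rfl
    have s1 : j + 1 - j = 0 + 1 := by omega
    simp only [Zop, aFun, Nat.sub_self, Nat.add_sub_cancel, s1]
    rw [show x - 1 + a = x + a - 1 by ring]
    rw [poch_sub_one_succ]
    simp only [poch_succ, poch_zero]
    push_cast at e2 e3 ⊢
    have d2 : (j : ℂ) + 1 + a - 1 = j + a := by ring
    have d3 : 2 * a + 2 * ((j : ℂ) + 1) - 1 = 2 * a + 2 * j + 1 := by ring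
    rw [d2] at e2 ⊢
    rw [d3] at e3 ⊢
    replace e3 : 2 * (a + j) + 1 ≠ 0 := by rwa [mul_add]
    field_simp
    ring
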